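/- Let m, s be positive integers with s ≡ 0 or −1 (mod m), let a, d_1, d_2 ∈ ℤ/mℤ with d_2 and d_2 − d_1 invertible, and let Δ = AS(a, (d_1, d_2), s). Then m_Δ(x) = m_Δ(x + gcd(d_1, m)) for all x ∈ ℤ/mℤ, and m_Δ(a + i d_2) = (1/m)C(s+1,2) + ⌈s/m⌉·((gcd(d_1,m)−1)/2 − i) for all integers i ∈ [0, gcd(d_1,m)−1]. -/

import Mathlib

open Finset

/-- Index set of an `n`-simplex of size `s`: all `i : Fin n → ℕ` with `∑ k, i k ≤ s - 1`,
i.e. `∑ k, i k < s`. -/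
def simplexIdx (n s : ℕ) : Finset (Fin n → ℕ) :=
  (Fintype.piFinset fun _ : Fin n => Finset.range s).filter fun i => ∑ k, i k < s

/-- The arithmetic `n`-simplex `AS(a, d, s)` as a multiset of `ZMod m`. -/
def AS (m n : ℕ) (a : ZMod m) (d : Fin n → ZMod m) (s : ℕ) : Multiset (ZMod m) :=
  (simplexIdx n s).val.map fun i => a + ∑ k, (i k : ZMod m) * d k

/-- A finite multiset of `ZMod m` is balanced if every element of `ZMod m` occurs with the
same multiplicity. -/
def IsBalanced {m : ℕ} (M : Multiset (ZMod m)) : Prop :=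
  ∀ x y : ZMod m, M.count x = M.count y

/-- The number of indices `j < s` with `b + j u = x`. -/
def progCount {m : ℕ} (s : ℕ) (b u x : ZMod m) : ℚ :=
  ∑ j ∈ range s, if b + (j : ZMod m) * u = x then 1 else 0

/-- The multiplicity function of an arithmetic triangle, as a double sum. -/
def triCount {m : ℕ} (s : ℕ) (a d e x : ZMod m) : ℚ :=
  ∑ i ∈ range s, ∑ j ∈ range (s - i),
    if a + (i : ZMod m) * d + (j : ZMod m) * e = x then 1 else 0

theorem sum_triangle_eq_ite (s : ℕ) (P : ℕ → ℕ → ℚ) :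
    ∑ i ∈ range s, ∑ j ∈ range (s - i), P i j =
      ∑ i ∈ range s, ∑ j ∈ range s, if i + j < s then P i j else 0 := by
  refine sum_congr rfl fun i _ => ?_
  rw [← sum_filter]
  refine sum_congr ?_ fun _ _ => rfl
  ext j
  simp only [mem_range, mem_filter]
  omega

theorem triCount_comm {m : ℕ} (s : ℕ) (a d e x : ZMod m) :
    triCount s a d e x = triCount s a e d x := by
  rw [triCount, triCount, sum_triangle_eq_ite, sum_triangle_eq_ite, sum_comm]
  refine sum_congr rfl fun i _ => sum_congr rfl fun j _ => ?_
  rw [add_comm j i, add_right_comm]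

theorem count_AS_two {m : ℕ} (s : ℕ) (a d e x : ZMod m) :
    ((AS m 2 a ![d, e] s).count x : ℚ) = triCount s a d e x := by
  rw [triCount, sum_triangle_eq_ite, AS, Multiset.count_map, ← Finset.filter_val, Finset.card_val,
    ← Finset.sum_boole, simplexIdx, sum_filter, ← sum_product']
  refine sum_nbij' (fun i => (i 0, i 1)) (fun p => ![p.1, p.2]) ?_ ?_ ?_ ?_ ?_
  · intro i hi
    simpa [Fintype.mem_piFinset] using hi
  · intro p hp
    simpa [Fintype.mem_piFinset] using hp
  · intro i _
    ext k
    fin_cases k <;> rfl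
  · intro p _
    rfl
  · intro i _
    simp [Fin.sum_univ_two, add_assoc, eq_comm]

theorem triCount_sub_shift {m : ℕ} (s : ℕ) (a d e x : ZMod m) :
    triCount s a d e x - triCount s a d e (x - e) =
      progCount s a d x - progCount s (a + (s : ZMod m) * e) (d - e) x := by
  simp only [triCount, progCount, ← sum_sub_distrib]
  refine sum_congr rfl fun i hi => ?_
  have hi' : i ≤ s := (mem_range.1 hi).le
  have key := sum_range_sub' (fun j : ℕ =>
    if a + (i : ZMod m) * d + (j : ZMod m) * e = x then (1 : ℚ) else 0) (s - i)
  have last : a + (i : ZMod m) * d + ((s - i : ℕ) : ZMod m) * e =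
      a + s * e + i * (d - e) := by
    push_cast [hi']
    ring
  rw [last] at key
  simp only [Nat.cast_zero, zero_mul, add_zero] at key
  rw [← key]
  refine sum_congr rfl fun j _ => ?_
  congr 2
  rw [eq_sub_iff_add_eq, Nat.cast_succ, add_mul, one_mul, ← add_assoc]

theorem sum_range_natCast_zmod {m : ℕ} [NeZero m] (F : ZMod m → ℚ) :
    ∑ j ∈ range m, F j = ∑ z, F z := by
  refine sum_nbij' (fun j => (j : ZMod m)) ZMod.val ?_ ?_ ?_ ?_ ?_
  · simp
  · intro z _
    exact mem_range.2 (ZMod.val_lt z)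
  · intro j hj
    exact ZMod.val_cast_of_lt (mem_range.1 hj)
  · intro z _
    exact ZMod.natCast_zmod_val z
  · simp

theorem sum_range_mul_of_periodic {g : ℕ} {h : ℕ → ℚ} (hh : Function.Periodic h g) (n : ℕ) :
    ∑ j ∈ range (g * n), h j = n * ∑ j ∈ range g, h j := by
  induction n with
  | zero => simp
  | succ n ih =>
    rw [Nat.mul_succ, sum_range_add, ih]
    have : ∀ j, h (g * n + j) = h j := fun j => by
      rw [add_comm, mul_comm]
      exact hh.nat_mul n j
    simp only [this]
    push_cast
    ring

theorem progCount_mul {m : ℕ} [NeZero m] (k : ℕ) (b x : ZMod m) {u : ZMod m} (hu : IsUnit u) :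
    progCount (m * k) b u x = k := by
  rw [progCount, sum_range_mul_of_periodic (fun j => by simp),
    sum_range_natCast_zmod (fun z => if b + z * u = x then (1 : ℚ) else 0)]
  obtain ⟨u, rfl⟩ := hu
  have : ∀ z : ZMod m, b + z * u = x ↔ z = (x - b) * (u⁻¹ : (ZMod m)ˣ) := fun z => by
    rw [Units.eq_mul_inv_iff_mul_eq, eq_sub_iff_add_eq, add_comm]
  simp [this]

theorem progCount_of_succ_eq_mul {m s k : ℕ} [NeZero m] (hk : s + 1 = m * k) (b x : ZMod m)
    {u : ZMod m} (hu : IsUnit u) :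
    progCount s b u x = k - if b - u = x then 1 else 0 := by
  have hs : (s : ZMod m) = -1 := by
    rw [eq_neg_iff_add_eq_zero]
    simpa using congrArg (Nat.cast : ℕ → ZMod m) hk
  rw [← progCount_mul k b x hu, ← hk, progCount, progCount, sum_range_succ, hs, neg_one_mul,
    ← sub_eq_add_neg, add_sub_cancel_right]

theorem sum_triCount {m : ℕ} [NeZero m] (s : ℕ) (a d e : ZMod m) :
    ∑ x, triCount s a d e x = (s + 1).choose 2 := by
  simp only [triCount]
  rw [sum_comm]
  have : ∀ i ∈ range s, ∑ x : ZMod m, ∑ j ∈ range (s - i),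
      (if a + (i : ZMod m) * d + (j : ZMod m) * e = x then (1 : ℚ) else 0) = (s - i : ℕ) := by
    intro i _
    rw [sum_comm]
    simp
  have reflect := sum_range_reflect (fun i => i) (s + 1)
  rw [sum_congr rfl this, ← Nat.cast_sum, Nat.cast_inj, Nat.choose_two_right, ← sum_range_id,
    ← reflect, sum_range_succ]
  simp

theorem triCount_periodic {m s : ℕ} [NeZero m] (hsm : (s : ZMod m) = 0 ∨ (s : ZMod m) = -1)
    (a : ZMod m) {d e : ZMod m} (he : IsUnit e) (hed : IsUnit (e - d)) :
    Function.Periodic (triCount s a d e) d := by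
  intro x
  have key := triCount_sub_shift s a e d (x + d)
  rw [add_sub_cancel_right, triCount_comm, triCount_comm (x := x)] at key
  rw [← sub_eq_zero, key]
  rcases hsm with h | h
  · obtain ⟨k, rfl⟩ := (ZMod.natCast_eq_zero_iff s m).1 h
    rw [progCount_mul k _ _ he, progCount_mul k _ _ hed, sub_self]
  · obtain ⟨k, hk⟩ := (ZMod.natCast_eq_zero_iff (s + 1) m).1 (by simp [h])
    have : a + s * d - (e - d) = a - e := by
      rw [h]
      ring
    rw [progCount_of_succ_eq_mul hk _ _ he, progCount_of_succ_eq_mul hk _ _ hed, this, sub_self]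

theorem natCast_gcd_val_eq_mul {m : ℕ} [NeZero m] (d : ZMod m) :
    ∃ n : ℕ, ((Nat.gcd d.val m : ℕ) : ZMod m) = n * d := by
  refine ⟨((Nat.gcdA d.val m : ℤ) : ZMod m).val, ?_⟩
  have h := congrArg (Int.cast : ℤ → ZMod m) (Nat.gcd_eq_gcd_ab d.val m)
  push_cast at h
  rw [h, ZMod.natCast_zmod_val, ZMod.natCast_zmod_val, ZMod.natCast_self]
  ring

theorem natCast_mul_ne_of_lt_gcd {m r : ℕ} [NeZero m] {d e : ZMod m} (he : IsUnit e)
    (hr : r ≠ 0) (hrg : r < Nat.gcd d.val m) (z : ZMod m) : (r : ZMod m) * e ≠ z * d := by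
  intro h
  let φ := ZMod.castHom (Nat.gcd_dvd_right d.val m) (ZMod (Nat.gcd d.val m))
  have hd : φ d = 0 := by
    have h := map_natCast φ d.val
    rw [ZMod.natCast_zmod_val] at h
    rw [h, ZMod.natCast_eq_zero_iff]
    exact Nat.gcd_dvd_left _ _
  have h0 := congrArg φ h
  rw [map_mul, map_mul, hd, mul_zero, map_natCast, (he.map φ).mul_left_eq_zero,
    ZMod.natCast_eq_zero_iff] at h0
  exact hr (Nat.eq_zero_of_dvd_of_lt h0 hrg)

theorem progCount_eq_zero_of_lt_gcd {m r : ℕ} [NeZero m] (s : ℕ) (a : ZMod m) {d e : ZMod m}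
    (he : IsUnit e) (hr : r ≠ 0) (hrg : r < Nat.gcd d.val m) :
    progCount s a d (a + r * e) = 0 := by
  refine sum_eq_zero fun j _ => if_neg fun h => ?_
  exact natCast_mul_ne_of_lt_gcd he hr hrg j (add_left_cancel h).symm

theorem ceil_div_eq_of_succ_eq_mul {m s k : ℕ} (hm : 1 < m) (hk : s + 1 = m * k) :
    ⌈(s : ℚ) / m⌉ = k := by
  have hm' : (1 : ℚ) < m := by exact_mod_cast hm
  have hk' : (s : ℚ) + 1 = m * k := by exact_mod_cast hk
  rw [Int.ceil_eq_iff, lt_div_iff₀ (by linarith), div_le_iff₀ (by linarith)]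
  push_cast
  constructor <;> nlinarith

theorem triCount_succ {m s r : ℕ} [NeZero m] (hsm : (s : ZMod m) = 0 ∨ (s : ZMod m) = -1)
    (a : ZMod m) {d e : ZMod m} (he : IsUnit e) (hed : IsUnit (e - d))
    (hr : r + 1 < Nat.gcd d.val m) :
    triCount s a d e (a + (r + 1 : ℕ) * e) = triCount s a d e (a + r * e) - ⌈(s : ℚ) / m⌉ := by
  have hde : IsUnit (d - e) := by simpa using hed.neg
  have key := triCount_sub_shift s a d e (a + (r + 1 : ℕ) * e)
  have hshift : a + ((r + 1 : ℕ) : ZMod m) * e - e = a + r * e := by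
    push_cast
    ring
  rw [hshift, progCount_eq_zero_of_lt_gcd s a he r.succ_ne_zero hr] at key
  suffices progCount s (a + (s : ZMod m) * e) (d - e) (a + (r + 1 : ℕ) * e) = ⌈(s : ℚ) / m⌉ by
    linarith
  have hm : 1 < m := by
    have := Nat.le_of_dvd (NeZero.pos m) (Nat.gcd_dvd_right d.val m)
    omega
  rcases hsm with h | h
  · obtain ⟨k, rfl⟩ := (ZMod.natCast_eq_zero_iff s m).1 h
    have : (m : ℚ) ≠ 0 := NeZero.ne _
    rw [progCount_mul k _ _ hde, Nat.cast_mul, mul_div_cancel_left₀ _ this, Int.ceil_natCast,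
      Int.cast_natCast]
  · obtain ⟨k, hk⟩ := (ZMod.natCast_eq_zero_iff (s + 1) m).1 (by simp [h])
    rw [progCount_of_succ_eq_mul hk _ _ hde, ceil_div_eq_of_succ_eq_mul hm hk, if_neg, sub_zero,
      Int.cast_natCast]
    intro hx
    refine natCast_mul_ne_of_lt_gcd he r.succ_ne_zero hr (-1) ?_
    rw [h] at hx
    linear_combination -hx

theorem sum_range_natCast_id (n : ℕ) : ∑ i ∈ range n, (i : ℚ) = n * (n - 1) / 2 := by
  induction n with
  | zero => simp
  | succ n ih =>
    rw [sum_range_succ, ih]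
    push_cast
    ring

/-- For `s ≡ 0` or `-1 (mod m)` and `d₂`, `d₂ - d₁` invertible, the multiplicity function of
the arithmetic triangle `Δ = AS(a, (d₁, d₂), s)` is periodic of period `gcd(d₁, m)` and
`m_Δ(a + i d₂) = (1/m)·C(s+1, 2) + ⌈s/m⌉·((gcd(d₁,m)−1)/2 − i)` for `0 ≤ i < gcd(d₁, m)`. -/
theorem stmt11 (m s : ℕ) (hm : 0 < m) (hs : 0 < s)
    (hsm : (s : ZMod m) = 0 ∨ (s : ZMod m) = -1)
    (a d₁ d₂ : ZMod m) (h₂ : IsUnit d₂) (h₂₁ : IsUnit (d₂ - d₁)) :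
    (∀ x : ZMod m,
      (AS m 2 a ![d₁, d₂] s).count x =
        (AS m 2 a ![d₁, d₂] s).count (x + (Nat.gcd (ZMod.val d₁) m : ZMod m))) ∧
    (∀ i : ℕ, i < Nat.gcd (ZMod.val d₁) m →
      ((AS m 2 a ![d₁, d₂] s).count (a + (i : ZMod m) * d₂) : ℚ) =
        (Nat.choose (s + 1) 2 : ℚ) / m +
          (⌈(s : ℚ) / m⌉ : ℚ) * (((Nat.gcd (ZMod.val d₁) m : ℚ) - 1) / 2 - i)) := by
  have : NeZero m := ⟨hm.ne'⟩
  obtain ⟨n, hn⟩ := natCast_gcd_val_eq_mul d₁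
  have per : Function.Periodic (triCount s a d₁ d₂) (Nat.gcd d₁.val m : ℕ) := by
    rw [hn]
    exact (triCount_periodic hsm a h₂ h₂₁).nat_mul n
  refine ⟨fun x => ?_, ?_⟩
  · rw [← Nat.cast_inj (R := ℚ), count_AS_two, count_AS_two, per x]
  obtain ⟨q, hq⟩ := Nat.gcd_dvd_right d₁.val m
  simp only [count_AS_two]
  set g := Nat.gcd d₁.val m
  set c : ℚ := ((⌈(s : ℚ) / m⌉ : ℤ) : ℚ)
  have arith : ∀ i < g, triCount s a d₁ d₂ (a + i * d₂) = triCount s a d₁ d₂ a - c * i := by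
    intro i
    induction i with
    | zero => simp
    | succ r ih =>
      intro hr
      rw [triCount_succ hsm a h₂ h₂₁ hr, ih (by omega)]
      push_cast
      ring
  have total : ∑ j ∈ range m, triCount s a d₁ d₂ (a + j * d₂) = (s + 1).choose 2 := by
    rw [sum_range_natCast_zmod (fun z => triCount s a d₁ d₂ (a + z * d₂)),
      ← sum_triCount s a d₁ d₂]
    obtain ⟨u, rfl⟩ := h₂
    exact (u.mulRight.trans (Equiv.addLeft a)).sum_comp (triCount s a d₁ (u : ZMod m))
  have per' : Function.Periodic (fun j : ℕ => triCount s a d₁ d₂ (a + j * d₂)) g := by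
    intro j
    have := per.nat_mul d₂.val (a + j * d₂)
    rw [ZMod.natCast_zmod_val] at this
    simp only [← this]
    congr 1
    push_cast
    ring
  have hm' : (m : ℚ) = g * q := by exact_mod_cast hq
  have hm0 : (m : ℚ) ≠ 0 := NeZero.ne _
  have split := sum_range_mul_of_periodic per' q
  rw [← hq, total, sum_congr rfl fun i hi => arith i (mem_range.1 hi), sum_sub_distrib, ← mul_sum,
    sum_range_natCast_id, sum_const, card_range, nsmul_eq_mul] at split
  intro i hi
  rw [arith i hi, split]
  field_simp
  rw [hm']
  ring
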